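/- Let $M \ge 1$ be a real number, let $m \ge 1$ be a natural number, and let $b_0, b_1, \dots, b_m$ be nonnegative real numbers such that $b_0 \le M$ and $b_p \le b_{p+1} + 2\sqrt{M}\,\sqrt{b_{p+1}}$ for every $0 \le p < m$. Then $b_0 \le 9\, M^2 \, b_m^{\,2^{-m}}$. -/

import Mathlib

/-- A sequence with `d p ^ 2 ≤ d (p + 1)` for `p < m` satisfies `d 0 ^ 2 ^ m ≤ d m`. -/
lemma pow_two_pow_le_of_sq_le {d : ℕ → ℝ} {m : ℕ} (h0 : 0 ≤ d 0)
    (h : ∀ p < m, d p ^ 2 ≤ d (p + 1)) : d 0 ^ 2 ^ m ≤ d m := by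
  induction m with
  | zero => simp
  | succ k ih =>
    calc d 0 ^ 2 ^ (k + 1) = (d 0 ^ 2 ^ k) ^ 2 := by rw [pow_succ, pow_mul]
      _ ≤ d k ^ 2 := by
        gcongr
        exact ih fun p hp => h p (by lia)
      _ ≤ d (k + 1) := h k (by lia)

/-- Truncating at `1` turns `x ≤ y + 2 √M √y` into a purely quadratic inequality. -/
lemma min_one_sq_le {M x y : ℝ} (hM : 1 ≤ M) (hx : 0 ≤ x) (hy : 0 ≤ y)
    (h : x ≤ y + 2 * Real.sqrt M * Real.sqrt y) : min x 1 ^ 2 ≤ 9 * M * min y 1 := by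
  have hx' : 0 ≤ min x 1 := le_min hx zero_le_one
  rcases le_total y 1 with hy1 | hy1
  · rw [min_eq_left hy1]
    have hy_le : y ≤ Real.sqrt M * Real.sqrt y := by
      calc y = Real.sqrt y * Real.sqrt y := (Real.mul_self_sqrt hy).symm
        _ ≤ Real.sqrt M * Real.sqrt y := by gcongr; exact hy1.trans hM
    calc min x 1 ^ 2 ≤ (3 * (Real.sqrt M * Real.sqrt y)) ^ 2 := by
          gcongr
          linarith [min_le_left x 1]
      _ = 9 * M * y := by
          rw [mul_pow, mul_pow, Real.sq_sqrt (by linarith), Real.sq_sqrt hy]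
          ring
  · rw [min_eq_right hy1]
    have : min x 1 ^ 2 ≤ 1 := pow_le_one₀ hx' (min_le_right x 1)
    linarith

/-- The quantitative core of the iteration argument in Lemma 3.1:
if `b 0 ≤ M` and `b p ≤ b (p+1) + 2√M √(b (p+1))` for `p < m`, then
`b 0 ≤ 9 M² (b m) ^ (2⁻ᵐ)`. -/
theorem stability_iteration_bound (M : ℝ) (hM : 1 ≤ M) (m : ℕ) (hm : 1 ≤ m)
    (b : ℕ → ℝ) (hb_nonneg : ∀ p ≤ m, 0 ≤ b p) (hb0 : b 0 ≤ M)
    (hrec : ∀ p < m, b p ≤ b (p + 1) + 2 * Real.sqrt M * Real.sqrt (b (p + 1))) :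
    b 0 ≤ 9 * M ^ 2 * (b m) ^ ((2 : ℝ) ^ (-(m : ℝ))) := by
  have hK : 0 < 9 * M := by linarith
  have hnn : 0 ≤ min (b 0) 1 / (9 * M) :=
    div_nonneg (le_min (hb_nonneg 0 (by lia)) zero_le_one) hK.le
  have hpow : (min (b 0) 1 / (9 * M)) ^ 2 ^ m ≤ min (b m) 1 / (9 * M) := by
    refine pow_two_pow_le_of_sq_le (d := fun p => min (b p) 1 / (9 * M)) hnn fun p hp => ?_
    have h := min_one_sq_le hM (hb_nonneg p hp.le) (hb_nonneg (p + 1) hp) (hrec p hp)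
    rw [div_pow, div_le_div_iff₀ (by positivity) hK]
    nlinarith
  have hpow_le : (min (b 0) 1 / (9 * M)) ^ 2 ^ m ≤ b m := by
    refine hpow.trans ((div_le_iff₀ hK).2 ?_)
    nlinarith [min_le_left (b m) 1, hb_nonneg m le_rfl]
  have hexp : (2 : ℝ) ^ (-(m : ℝ)) = ((2 ^ m : ℕ) : ℝ)⁻¹ := by
    rw [Real.rpow_neg zero_le_two, Real.rpow_natCast]
    push_cast
    rfl
  have hroot : min (b 0) 1 / (9 * M) ≤ b m ^ ((2 : ℝ) ^ (-(m : ℝ))) := by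
    rw [hexp, ← Real.pow_rpow_inv_natCast hnn (pow_ne_zero m two_ne_zero)]
    exact Real.rpow_le_rpow (by positivity) hpow_le (by positivity)
  have hmin : b 0 ≤ M * min (b 0) 1 := by
    rcases le_total (b 0) 1 with h | h
    · rw [min_eq_left h]
      nlinarith [hb_nonneg 0 (by lia)]
    · rwa [min_eq_right h, mul_one]
  calc b 0 ≤ M * min (b 0) 1 := hmin
    _ ≤ M * (b m ^ ((2 : ℝ) ^ (-(m : ℝ))) * (9 * M)) := by
      gcongr
      exact (div_le_iff₀ hK).1 hroot
    _ = 9 * M ^ 2 * (b m) ^ ((2 : ℝ) ^ (-(m : ℝ))) := by ring
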